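/- Let g ∈ ℤ[x] be x²-divisible of degree d ≥ 3 and let c ∈ ℚ. Then for all integers 0 ≤ n' ≤ n one has ln B_n ≥ (d^{n−n'}/3) · ln(B̂_{n'}). -/

import Mathlib

open Polynomial

/-- The `n`-th iterate of `g_c := g + c` applied to `0`, for `g ∈ ℤ[x]` and `c ∈ ℚ`. -/
noncomputable def gcIter (g : ℤ[X]) (c : ℚ) (n : ℕ) : ℚ :=
  (fun x : ℚ => (g.map (Int.castRingHom ℚ)).eval x + c)^[n] 0

/-- `g` is `x²`-divisible: degree at least 2 and zero constant and linear coefficients. -/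
def IsX2Divisible (g : ℤ[X]) : Prop :=
  2 ≤ g.natDegree ∧ g.coeff 0 = 0 ∧ g.coeff 1 = 0

/-- The length `L_g = 1 + ∑_{i=2}^{d-1} |u_i|/|u_d|` of an `x²`-divisible polynomial. -/
noncomputable def Lg (g : ℤ[X]) : ℝ :=
  1 + ∑ i ∈ Finset.Ico 2 g.natDegree, (|g.coeff i| : ℝ) / (|g.leadingCoeff| : ℝ)

/-- `S_g`: the set of `c ∈ ℚ` such that the sequence `{g_c^n(0)}_{n ≥ 1}` takes
infinitely many values. -/
def Sg (g : ℤ[X]) : Set ℚ :=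
  {c : ℚ | (Set.range fun n : ℕ => gcIter g c (n + 1)).Infinite}

/-- The numerator `A_n` of `g_c^{n+1}(0) = g_c^n(c) = A_n / B_n` in lowest terms. -/
noncomputable def An (g : ℤ[X]) (c : ℚ) (n : ℕ) : ℤ := (gcIter g c (n + 1)).num

/-- The (positive) denominator `B_n` of `g_c^{n+1}(0) = g_c^n(c) = A_n / B_n`
in lowest terms. -/
noncomputable def Bn (g : ℤ[X]) (c : ℚ) (n : ℕ) : ℕ := (gcIter g c (n + 1)).den

/-- For a natural number `a`, the factor `â = ∏_{p ∈ I(a)} p^{val_p(a)}`, where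
`I(a)` consists of the primes `p` with `val_p(a) > val_p(u_d)`. -/
noncomputable def hatB (g : ℤ[X]) (a : ℕ) : ℕ :=
  ∏ p ∈ a.primeFactors.filter
      (fun p => padicValInt p g.leadingCoeff < padicValNat p a),
    p ^ padicValNat p a

/-- `g` has rapidly increasing numerators on `S`: there is an integer `N > 0` such that
for every `c ∈ S` there is a finite set `J_c ⊆ ℕ` with `#J_c ≤ N` such that for every
`n ≥ 1` outside `J_c` one has `ln |A_n| > ∑_{p ∣ n} ln |A_{n/p}|`. -/
def RapidlyIncreasingNumerators (g : ℤ[X]) (S : Set ℚ) : Prop :=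
  ∃ N : ℕ, 0 < N ∧ ∀ c ∈ S, ∃ J : Finset ℕ, J.card ≤ N ∧
    ∀ n : ℕ, 1 ≤ n → n ∉ J →
      (∑ p ∈ n.primeFactors, Real.log |(An g c (n / p) : ℝ)|) <
        Real.log |(An g c n : ℝ)|

/-- Over a prime dividing the denominator, the `p`-adic norm is the `p`-part of the denominator. -/
theorem padicNorm_eq_pow_padicValNat_den {p : ℕ} [Fact p.Prime] {x : ℚ} (h : p ∣ x.den) :
    padicNorm p x = (p : ℚ) ^ padicValNat p x.den := by
  have hx : x ≠ 0 := by
    rintro rfl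
    exact (Fact.out : p.Prime).one_lt.ne' (by simpa using h)
  have hnum : ¬ (p : ℤ) ∣ x.num := fun hdvd =>
    Nat.not_coprime_of_dvd_of_dvd (Fact.out : p.Prime).one_lt
      (Int.natCast_dvd.mp hdvd) h x.reduced
  rw [padicNorm.eq_zpow_of_nonzero hx, padicValRat, padicValInt.eq_zero_of_not_dvd hnum]
  simp

/-- The `p`-adic norm is at most the `p`-part of the denominator. -/
theorem padicNorm_le_pow_padicValNat_den {p : ℕ} [Fact p.Prime] (x : ℚ) :
    padicNorm p x ≤ (p : ℚ) ^ padicValNat p x.den := by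
  by_cases h : p ∣ x.den
  · exact (padicNorm_eq_pow_padicValNat_den h).le
  · rw [padicValNat.eq_zero_of_not_dvd h, pow_zero]
    nth_rw 1 [← Rat.num_div_den x]
    rw [padicNorm.div, (padicNorm.nat_eq_one_iff _).mpr h, div_one]
    exact padicNorm.of_int _

/-- If `|u_d|_p |x|_p > 1` then the leading term dominates the value of `g` at `x`, even after
adding a constant which is no larger than `x`. -/
theorem padicNorm_eval_add_of_one_lt {p : ℕ} [Fact p.Prime] {g : ℤ[X]} (hd : 2 ≤ g.natDegree)
    {x c : ℚ} (hx : 1 < padicNorm p g.leadingCoeff * padicNorm p x)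
    (hc : padicNorm p c ≤ padicNorm p x) :
    padicNorm p ((g.map (Int.castRingHom ℚ)).eval x + c) =
      padicNorm p g.leadingCoeff * padicNorm p x ^ g.natDegree := by
  have hu : padicNorm p g.leadingCoeff ≤ 1 := padicNorm.of_int _
  have hx0 : 0 ≤ padicNorm p x := padicNorm.nonneg _
  have hx1 : 1 < padicNorm p x := hx.trans_le (mul_le_of_le_one_left hx0 hu)
  obtain ⟨m, hm⟩ : ∃ m, g.natDegree = m + 1 := ⟨g.natDegree - 1, by omega⟩
  have hlead : padicNorm p x ^ m < padicNorm p g.leadingCoeff * padicNorm p x ^ g.natDegree := by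
    have := mul_lt_mul_of_pos_right hx (pow_pos (zero_lt_one.trans hx1) m)
    rw [hm, pow_succ']
    linarith
  have heval : (g.map (Int.castRingHom ℚ)).eval x =
      (∑ i ∈ Finset.range g.natDegree, (g.coeff i : ℚ) * x ^ i) +
        (g.leadingCoeff : ℚ) * x ^ g.natDegree := by
    rw [eval_map, eval₂_eq_sum_range, Finset.sum_range_succ]
    rfl
  have hsum : padicNorm p (∑ i ∈ Finset.range g.natDegree, (g.coeff i : ℚ) * x ^ i) ≤
      padicNorm p x ^ m := by
    refine padicNorm.sum_le' (fun i hi => ?_) (by positivity)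
    rw [padicNorm.mul, IsAbsoluteValue.abv_pow (padicNorm p)]
    have hi' : i ≤ m := by have := Finset.mem_range.mp hi; omega
    calc _ ≤ 1 * padicNorm p x ^ i := by
            gcongr
            exact padicNorm.of_int _
      _ ≤ padicNorm p x ^ m := by
            rw [one_mul]
            exact pow_le_pow_right₀ hx1.le hi'
  have hrest : padicNorm p ((∑ i ∈ Finset.range g.natDegree, (g.coeff i : ℚ) * x ^ i) + c) ≤
      padicNorm p x ^ m :=
    padicNorm.nonarchimedean.trans
      (max_le hsum (hc.trans (le_self_pow₀ hx1.le (by omega))))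
  have hterm : padicNorm p ((g.leadingCoeff : ℚ) * x ^ g.natDegree) =
      padicNorm p g.leadingCoeff * padicNorm p x ^ g.natDegree := by
    rw [padicNorm.mul, IsAbsoluteValue.abv_pow (padicNorm p)]
  have hlt := hrest.trans_lt (hlead.trans_eq hterm.symm)
  rw [heval, add_right_comm, padicNorm.add_eq_max_of_ne hlt.ne, max_eq_right hlt.le, hterm]

theorem gcIter_succ (g : ℤ[X]) (c : ℚ) (n : ℕ) :
    gcIter g c (n + 1) = (g.map (Int.castRingHom ℚ)).eval (gcIter g c n) + c :=
  Function.iterate_succ_apply' _ _ _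

theorem gcIter_one {g : ℤ[X]} (h0 : g.coeff 0 = 0) (c : ℚ) : gcIter g c 1 = c := by
  rw [gcIter_succ]
  simp [gcIter, eval_map, eval₂_at_zero, h0]

section

variable {p : ℕ} [Fact p.Prime] {g : ℤ[X]} {c : ℚ}

/-- Once `|u_d|_p |x|_p > 1` and `|c|_p ≤ |x|_p` hold for an iterate `x`, they hold for the next. -/
theorem padicNorm_gcIter_succ (hd : 2 ≤ g.natDegree) {m : ℕ}
    (hx : 1 < padicNorm p g.leadingCoeff * padicNorm p (gcIter g c m))
    (hc : padicNorm p c ≤ padicNorm p (gcIter g c m)) :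
    padicNorm p (gcIter g c (m + 1)) =
        padicNorm p g.leadingCoeff * padicNorm p (gcIter g c m) ^ g.natDegree ∧
      1 < padicNorm p g.leadingCoeff * padicNorm p (gcIter g c (m + 1)) ∧
      padicNorm p c ≤ padicNorm p (gcIter g c (m + 1)) := by
  have heq := padicNorm_eval_add_of_one_lt hd hx hc
  rw [← gcIter_succ] at heq
  have hu : padicNorm p g.leadingCoeff ≤ 1 := padicNorm.of_int _
  have hx0 : 0 ≤ padicNorm p (gcIter g c m) := padicNorm.nonneg _
  have hx1 := hx.trans_le (mul_le_of_le_one_left hx0 hu)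
  have hmono : padicNorm p (gcIter g c m) ≤ padicNorm p (gcIter g c (m + 1)) := by
    obtain ⟨k, hk⟩ : ∃ k, g.natDegree = k + 1 := ⟨g.natDegree - 1, by omega⟩
    rw [heq, hk, pow_succ', ← mul_assoc]
    calc _ ≤ padicNorm p (gcIter g c m) ^ k := le_self_pow₀ hx1.le (by omega)
      _ ≤ _ := le_mul_of_one_le_left (by positivity) hx.le
  exact ⟨heq, hx.trans_le (mul_le_mul_of_nonneg_left hmono (padicNorm.nonneg _)),
    hc.trans hmono⟩

/-- `|u_d|_p |x|_p > 1` for some iterate `x` implies `|c|_p ≤ |x|_p`. -/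
theorem padicNorm_le_padicNorm_gcIter (hd : 2 ≤ g.natDegree) (h0 : g.coeff 0 = 0) {n : ℕ}
    (hx : 1 < padicNorm p g.leadingCoeff * padicNorm p (gcIter g c (n + 1))) :
    padicNorm p c ≤ padicNorm p (gcIter g c (n + 1)) := by
  by_cases hc : 1 < padicNorm p g.leadingCoeff * padicNorm p c
  · have key : ∀ m, 1 < padicNorm p g.leadingCoeff * padicNorm p (gcIter g c (m + 1)) ∧
        padicNorm p c ≤ padicNorm p (gcIter g c (m + 1)) := by
      intro m
      induction m with
      | zero => simpa [gcIter_one h0] using hc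
      | succ m ih => exact (padicNorm_gcIter_succ hd ih.1 ih.2).2
    exact (key n).2
  · exact (lt_of_mul_lt_mul_left ((not_lt.mp hc).trans_lt hx) (padicNorm.nonneg _)).le

/-- Growth of the `p`-adic norms of the iterates. -/
theorem padicNorm_gcIter_pow_le (hd : 3 ≤ g.natDegree) (h0 : g.coeff 0 = 0) {n : ℕ}
    (hx : 1 < padicNorm p g.leadingCoeff * padicNorm p (gcIter g c (n + 1))) (k : ℕ) :
    padicNorm p (gcIter g c (n + 1)) ^ g.natDegree ^ k ≤
      padicNorm p (gcIter g c (n + k + 1)) ^ 2 := by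
  have hu : padicNorm p g.leadingCoeff ≤ 1 := padicNorm.of_int _
  have hu0 : 0 ≤ padicNorm p g.leadingCoeff := padicNorm.nonneg _
  have hd2 : 2 ≤ g.natDegree := by omega
  have hn0 : 0 ≤ padicNorm p (gcIter g c (n + 1)) := padicNorm.nonneg _
  have key : 1 < padicNorm p g.leadingCoeff * padicNorm p (gcIter g c (n + k + 1)) ∧
      padicNorm p c ≤ padicNorm p (gcIter g c (n + k + 1)) ∧
      padicNorm p (gcIter g c (n + 1)) ^ g.natDegree ^ k ≤
        padicNorm p g.leadingCoeff * padicNorm p (gcIter g c (n + k + 1)) ^ 2 := by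
    induction k with
    | zero =>
      refine ⟨hx, padicNorm_le_padicNorm_gcIter hd2 h0 hx, ?_⟩
      rw [pow_zero, pow_one, add_zero, sq, ← mul_assoc]
      exact le_mul_of_one_le_left hn0 hx.le
    | succ k ih =>
      obtain ⟨h1, h2, h3⟩ := ih
      obtain ⟨heq, h1', h2'⟩ := padicNorm_gcIter_succ hd2 h1 h2
      refine ⟨h1', h2', ?_⟩
      rw [← add_assoc, heq, pow_succ, pow_mul]
      have hk0 : 0 ≤ padicNorm p (gcIter g c (n + k + 1)) := padicNorm.nonneg _
      calc _ ≤ (padicNorm p g.leadingCoeff * padicNorm p (gcIter g c (n + k + 1)) ^ 2) ^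
              g.natDegree := by gcongr
        _ = padicNorm p g.leadingCoeff ^ g.natDegree *
              (padicNorm p (gcIter g c (n + k + 1)) ^ g.natDegree) ^ 2 := by
            rw [mul_pow, pow_right_comm]
        _ ≤ padicNorm p g.leadingCoeff ^ 3 *
              (padicNorm p (gcIter g c (n + k + 1)) ^ g.natDegree) ^ 2 := by
            gcongr ?_ * _
            exact pow_le_pow_of_le_one hu0 hu hd
        _ = _ := by ring
  exact key.2.2.trans (mul_le_of_le_one_left (by positivity) hu)

/-- Growth of the `p`-adic valuations of the denominators `B_n`. -/
theorem pow_mul_padicValNat_Bn_le (hd : 3 ≤ g.natDegree) (h0 : g.coeff 0 = 0) {n : ℕ}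
    (hlt : padicValInt p g.leadingCoeff < padicValNat p (Bn g c n)) (k : ℕ) :
    g.natDegree ^ k * padicValNat p (Bn g c n) ≤ 2 * padicValNat p (Bn g c (n + k)) := by
  have hp : (1 : ℚ) < p := by exact_mod_cast (Fact.out : p.Prime).one_lt
  have hu0 : (g.leadingCoeff : ℚ) ≠ 0 := by
    have : g ≠ 0 := by rintro rfl; simp at hd
    simpa using this
  have hdvd : p ∣ (gcIter g c (n + 1)).den := dvd_of_one_le_padicValNat (by
    have : padicValNat p (gcIter g c (n + 1)).den = padicValNat p (Bn g c n) := rfl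
    omega)
  have hxn := padicNorm_eq_pow_padicValNat_den hdvd
  have hx : 1 < padicNorm p g.leadingCoeff * padicNorm p (gcIter g c (n + 1)) := by
    rw [padicNorm.eq_zpow_of_nonzero hu0, padicValRat.of_int, hxn, ← zpow_natCast,
      ← zpow_add₀ (by positivity)]
    refine one_lt_zpow₀ hp ?_
    change 0 < -((padicValInt p g.leadingCoeff : ℕ) : ℤ) + (padicValNat p (Bn g c n) : ℕ)
    omega
  have hgrow := (padicNorm_gcIter_pow_le hd h0 hx k).trans
    (pow_le_pow_left₀ (padicNorm.nonneg _) (padicNorm_le_pow_padicValNat_den _) 2)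
  rw [hxn, ← pow_mul, ← pow_mul, pow_le_pow_iff_right₀ hp] at hgrow
  rw [mul_comm, mul_comm 2]
  exact hgrow

end

theorem hatB_ne_zero (g : ℤ[X]) (a : ℕ) : hatB g a ≠ 0 :=
  Finset.prod_ne_zero_iff.mpr fun _ hp =>
    pow_ne_zero _ (Nat.prime_of_mem_primeFactors (Finset.mem_filter.mp hp).1).ne_zero

theorem hatB_pow_dvd_Bn_sq {g : ℤ[X]} (hd : 3 ≤ g.natDegree) (h0 : g.coeff 0 = 0) (c : ℚ)
    (n k : ℕ) : hatB g (Bn g c n) ^ g.natDegree ^ k ∣ Bn g c (n + k) ^ 2 := by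
  rw [hatB, ← Finset.prod_pow]
  refine Finset.prod_dvd_of_isRelPrime (fun p hp q hq hpq => ?_) fun p hp => ?_
  · have hp' := Nat.prime_of_mem_primeFactors (Finset.mem_filter.mp hp).1
    have hq' := Nat.prime_of_mem_primeFactors (Finset.mem_filter.mp hq).1
    exact Nat.coprime_iff_isRelPrime.mp
      ((((Nat.coprime_primes hp' hq').mpr hpq).pow _ _).pow _ _)
  · obtain ⟨hp, hlt⟩ := Finset.mem_filter.mp hp
    have : Fact p.Prime := ⟨Nat.prime_of_mem_primeFactors hp⟩
    rw [← pow_mul]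
    calc _ ∣ p ^ (padicValNat p (Bn g c (n + k)) * 2) :=
          pow_dvd_pow _ (by linarith [pow_mul_padicValNat_Bn_le hd h0 hlt k])
      _ ∣ _ := by
          rw [pow_mul]
          exact pow_dvd_pow_of_dvd pow_padicValNat_dvd 2

/-- Lemma 2.11: for `g` of degree `d ≥ 3` and `0 ≤ n' ≤ n`,
`ln B_n ≥ (d^{n−n'} / 3) · ln B̂_{n'}`. -/
theorem log_Bn_lower_bound (g : ℤ[X]) (hg : IsX2Divisible g) (hd : 3 ≤ g.natDegree)
    (c : ℚ) (n' n : ℕ) (h : n' ≤ n) :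
    (g.natDegree : ℝ) ^ (n - n') / 3 * Real.log (hatB g (Bn g c n')) ≤
      Real.log (Bn g c n) := by
  obtain ⟨k, rfl⟩ := Nat.exists_eq_add_of_le h
  have hpos : 0 < Bn g c (n' + k) := Rat.den_pos _
  have hle := Nat.le_of_dvd (pow_pos hpos 2) (hatB_pow_dvd_Bn_sq hd hg.2.1 c n' k)
  have hlog := Real.log_le_log
    (by exact_mod_cast pow_pos (Nat.pos_of_ne_zero (hatB_ne_zero g (Bn g c n'))) _)
    (Nat.cast_le (α := ℝ) |>.mpr hle)
  push_cast [Real.log_pow] at hlog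
  have := Real.log_natCast_nonneg (Bn g c (n' + k))
  rw [Nat.add_sub_cancel_left]
  linarith
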